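/- arXiv:2009.03991 — 2 statements merged into one kernel-verified Lean document; each statement's English description precedes it below -/
import Mathlib

section
/- Let G be a homogeneous group with universal projection constant c_G, let 1 ≤ k ≤ υ, and let T, V ∈ H(G,k) be k-dimensional horizontal subgroups with ρ(T, V) < 1/3. Then for every ε₀ with 0 < ε₀ < c_G/3 and every p ∈ G, the cones X(p, V^⊥, ε₀) and X(p, T, ε₀) are disjoint, i.e. X(p, V^⊥, ε₀) ⊆ G ∖ X(p, T, ε₀). -/
open MeasureTheory Measure Metric Set Filter Topology ENNReal
open scoped NNReal

noncomputable section

/-- A homogeneous group: a connected, simply connected nilpotent Lie group identified with its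
graded Lie algebra `G = V₁ ⊕ ⋯ ⊕ V_ι` via the exponential map, equipped with intrinsic
dilations `δ_r`, a homogeneous (left-invariant, `1`-homogeneous) distance, and a fixed graded
scalar product (the layers being orthogonal to each other). -/
class HomogeneousGroup (G : Type*) extends MetricSpace G, Group G, AddCommGroup G, Module ℝ G where
  finiteDim : FiniteDimensional ℝ G
  /-- The group identity is the origin of the linear structure. -/
  one_def : (1 : G) = 0
  /-- The step `ι` of the group. -/
  step : ℕ
  step_pos : 0 < step
  /-- The layers `H^i` of the grading. -/
  layer : ℕ → Submodule ℝ G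
  layer_zero : layer 0 = ⊥
  layer_beyond : ∀ i : ℕ, step < i → layer i = ⊥
  /-- `G` is the direct sum of its layers. -/
  grading_internal : DirectSum.IsInternal layer
  /-- The fixed (graded) scalar product on `G`. -/
  ip : G →ₗ[ℝ] G →ₗ[ℝ] ℝ
  ip_symm : ∀ x y : G, ip x y = ip y x
  ip_pos : ∀ x : G, x ≠ 0 → 0 < ip x x
  /-- The layers are orthogonal to each other. -/
  ip_graded : ∀ i j : ℕ, i ≠ j → ∀ x ∈ layer i, ∀ y ∈ layer j, ip x y = 0
  /-- The intrinsic dilations `δ_r`. -/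
  dil : ℝ → G →ₗ[ℝ] G
  /-- `δ_r x = r^i x` on the `i`-th layer. -/
  dil_layer : ∀ (i : ℕ) (r : ℝ), ∀ x ∈ layer i, dil r x = r ^ i • x
  /-- Dilations with positive factor are group automorphisms. -/
  dil_hom : ∀ r : ℝ, 0 < r → ∀ x y : G, dil r (x * y) = dil r x * dil r y
  /-- The distance is left invariant. -/
  dist_left_invariant : ∀ z x y : G, dist (z * x) (z * y) = dist x y
  /-- The distance is `1`-homogeneous with respect to dilations. -/
  dist_dil : ∀ r : ℝ, 0 < r → ∀ x y : G, dist (dil r x) (dil r y) = r * dist x y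
  continuous_mul' : Continuous fun p : G × G => p.1 * p.2
  continuous_inv' : Continuous fun x : G => x⁻¹
  continuous_dil : ∀ r : ℝ, Continuous fun x : G => dil r x

namespace HomogeneousGroup

variable {G : Type*} [HomogeneousGroup G]

/-- `ℝ^k` with the Euclidean metric. -/
abbrev Ek (k : ℕ) := EuclideanSpace ℝ (Fin k)

/-- The homogeneous norm `‖x‖ = d(x, e)`. -/
def homNorm (x : G) : ℝ := dist x 1

/-- A homogeneous subgroup: a linear subspace of `G` which is a subgroup,
invariant under all dilations. -/
def IsHomogeneousSubgroup (S : Set G) : Prop :=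
  (∃ H : Subgroup G, S = (H : Set G)) ∧ (∃ V : Submodule ℝ G, S = (V : Set G)) ∧
    ∀ r : ℝ, 0 < r → ∀ x ∈ S, dil r x ∈ S

/-- A horizontal subgroup: a homogeneous subgroup contained in the first layer. -/
def IsHorizontalSubgroup (S : Set G) : Prop :=
  IsHomogeneousSubgroup S ∧ S ⊆ ((layer 1 : Submodule ℝ G) : Set G)

/-- `S ∈ H(G,k)`: a `k`-dimensional horizontal subgroup. -/
def IsHorizontal (k : ℕ) (S : Set G) : Prop :=
  IsHorizontalSubgroup S ∧ ∃ V : Submodule ℝ G, S = (V : Set G) ∧ Module.finrank ℝ V = k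

/-- `υ`: the maximal linear dimension among all horizontal subgroups of `G`. -/
def maxHorizDim (G : Type*) [HomogeneousGroup G] : ℕ :=
  sSup {k : ℕ | ∃ S : Set G, IsHorizontal k S}

/-- The magnification map `T_{p,r}(q) = δ_{1/r}(p⁻¹ q)`. -/
def mag (p : G) (r : ℝ) (q : G) : G := dil (1 / r) (p⁻¹ * q)

/-- The `k`-dimensional Hausdorff measure of the homogeneous distance, with the normalization
`H^k(A) = sup_δ inf {Σ 2^{-k} (diam E_i)^k}`. -/
def Hk (G : Type*) [HomogeneousGroup G] [MeasurableSpace G] [BorelSpace G] (k : ℕ) : Measure G :=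
  ((2 : ℝ≥0∞)⁻¹ ^ k) • μH[(k : ℝ)]

/-- A set `E ⊆ G` is `k`-rectifiable if, up to an `H^k`-negligible set, it is covered by
countably many Lipschitz images of subsets of `ℝ^k`. -/
def IsKRectifiable [MeasurableSpace G] [BorelSpace G] (k : ℕ) (E : Set G) : Prop :=
  ∃ (A : ℕ → Set (Ek k)) (f : ℕ → Ek k → G) (K : ℕ → ℝ≥0),
    (∀ i, LipschitzOnWith (K i) (f i) (A i)) ∧ Hk G k (E \ ⋃ i, f i '' A i) = 0

/-- A set `E ⊆ G` is purely `k`-unrectifiable if it meets every Lipschitz image of a subset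
of `ℝ^k` in an `H^k`-null set. -/
def IsPurelyKUnrectifiable [MeasurableSpace G] [BorelSpace G] (k : ℕ) (E : Set G) : Prop :=
  ∀ (A : Set (Ek k)) (f : Ek k → G) (K : ℝ≥0), LipschitzOnWith K f A → Hk G k (E ∩ f '' A) = 0

/-- Weak convergence of a one-parameter family of measures as `r → 0⁺`: convergence of the
integrals of all continuous compactly supported functions. -/
def WeakConvAtZero [MeasurableSpace G] (μ : ℝ → Measure G) (ν : Measure G) : Prop :=
  ∀ φ : G → ℝ, Continuous φ → HasCompactSupport φ →
    Tendsto (fun r : ℝ => ∫ x, φ x ∂(μ r)) (𝓝[>] (0 : ℝ)) (𝓝 (∫ x, φ x ∂ν))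

/-- The blow-up condition `r^{-k} (T_{p,r})_# (H^k ⌞ E) ⇀ H^k ⌞ T` as `r → 0⁺`. -/
def BlowUpTo [MeasurableSpace G] [BorelSpace G] (k : ℕ) (E : Set G) (p : G) (T : Set G) : Prop :=
  WeakConvAtZero
    (fun r : ℝ => (ENNReal.ofReal (r ^ k))⁻¹ • Measure.map (mag p r) ((Hk G k).restrict E))
    ((Hk G k).restrict T)

/-- `Tan(μ, p)`: the set of tangent measures of `μ` at `p`, i.e. the nonzero Radon measures
`ν` such that `c_i (T_{p,r_i})_# μ ⇀ ν` for some `c_i > 0` and `r_i → 0⁺`. -/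
def TangentMeasures [MeasurableSpace G] [BorelSpace G] (μ : Measure G) (p : G) :
    Set (Measure G) :=
  {ν | ν ≠ 0 ∧ IsLocallyFiniteMeasure ν ∧
    ∃ (c : ℕ → ℝ≥0) (r : ℕ → ℝ), (∀ i, 0 < c i) ∧ (∀ i, 0 < r i) ∧
      Tendsto r atTop (𝓝 0) ∧
      ∀ φ : G → ℝ, Continuous φ → HasCompactSupport φ →
        Tendsto (fun i => ∫ x, φ x ∂((c i : ℝ≥0∞) • Measure.map (mag p (r i)) μ)) atTop
          (𝓝 (∫ x, φ x ∂ν))}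

/-- The upper `k`-density `Θ*^k(μ, w) = limsup_{r→0⁺} μ(B(w,r))/r^k` of a measure. -/
def upperDensity [MeasurableSpace G] (k : ℕ) (μ : Measure G) (w : G) : ℝ≥0∞ :=
  Filter.limsup (fun r : ℝ => μ (ball w r) / ENNReal.ofReal (r ^ k)) (𝓝[>] (0 : ℝ))

/-- The upper `k`-density `Θ*^k(E, p) = limsup_{r→0⁺} H^k(E ∩ B(p,r))/r^k` of a set. -/
def upperDensitySet [MeasurableSpace G] [BorelSpace G] (k : ℕ) (E : Set G) (p : G) : ℝ≥0∞ :=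
  Filter.limsup (fun r : ℝ => Hk G k (E ∩ ball p r) / ENNReal.ofReal (r ^ k)) (𝓝[>] (0 : ℝ))

/-- The intrinsic cone `X(p, T, s) = {q ∈ G : d(p⁻¹q, T) < s d(p,q)}`. -/
def cone (p : G) (T : Set G) (s : ℝ) : Set G :=
  {q : G | infDist (p⁻¹ * q) T < s * dist p q}

/-- `T` is a `(k,G)`-approximate tangent group to `E` at `p`: a homogeneous subgroup of
linear dimension `k` and Hausdorff dimension `k`, with `Θ*^k(E,p) > 0`, such that for every
`s ∈ (0,1)` one has `r^{-k} H^k((E ∩ B(p,r)) ∖ X(p,T,s)) → 0` as `r → 0⁺`. -/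
def IsApproxTangentGroup [MeasurableSpace G] [BorelSpace G] (k : ℕ) (E : Set G) (p : G)
    (T : Set G) : Prop :=
  IsHomogeneousSubgroup T ∧ (∃ V : Submodule ℝ G, T = (V : Set G) ∧ Module.finrank ℝ V = k) ∧
    dimH T = (k : ℝ≥0∞) ∧ 0 < upperDensitySet k E p ∧
    ∀ s : ℝ, 0 < s → s < 1 →
      Tendsto (fun r : ℝ => Hk G k ((E ∩ ball p r) \ cone p T s) / ENNReal.ofReal (r ^ k))
        (𝓝[>] (0 : ℝ)) (𝓝 0)

/-- For a horizontal subgroup `V`, the vertical complementary subgroup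
`V^⊥ = (orthogonal of V in H¹) ⊕ H² ⊕ ⋯ ⊕ H^ι`; thanks to the graded scalar product it
consists exactly of the points orthogonal to every element of `V`. -/
def vertComp (V : Set G) : Set G := {x : G | ∀ v ∈ V, ip x v = 0}

/-- `π` is the horizontal projection onto the horizontal subgroup `V`, i.e.
`π(h₁ + ⋯ + h_ι)` is the orthogonal projection of `h₁` onto `V`; equivalently `π p` is the
unique element of `V` with the same scalar products with elements of `V` as `p`. -/
def IsHorizProj (V : Set G) (π : G → G) : Prop :=
  ∀ p : G, π p ∈ V ∧ ∀ w ∈ V, ip (π p) w = ip p w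

/-- `c` is a universal projection constant for `G`: `c ∈ (0,1)` and the distance estimates of
the projections onto horizontal subgroups and their vertical complements hold with constant
`c`, uniformly in the horizontal subgroup. -/
def IsProjConstant (G : Type*) [HomogeneousGroup G] (c : ℝ) : Prop :=
  0 < c ∧ c < 1 ∧
    ∀ V : Set G, IsHorizontalSubgroup V → ∀ π : G → G, IsHorizProj V π → ∀ p : G,
      homNorm (π p) ≤ c⁻¹ * homNorm p ∧
      c * homNorm (π p) ≤ infDist p (vertComp V) ∧
      infDist p (vertComp V) ≤ homNorm (π p) ∧
      c * homNorm ((π p)⁻¹ * (p * (π p)⁻¹) * π p) ≤ infDist p V ∧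
      infDist p V ≤ homNorm ((π p)⁻¹ * (p * (π p)⁻¹) * π p)

/-- The distance `ρ(V₁, V₂) = max_{‖x‖=1} d(π_{V₁}(x), π_{V₂}(x))` on the horizontal
Grassmannian, expressed through the horizontal projections. -/
def grassDist (π₁ π₂ : G → G) : ℝ :=
  sSup ((fun x : G => dist (π₁ x) (π₂ x)) '' {x : G | homNorm x = 1})

/-- The diameter of a set with respect to an arbitrary distance function. -/
def ediamWith {α : Type*} (d : α → α → ℝ) (t : Set α) : ℝ≥0∞ :=
  ⨆ x ∈ t, ⨆ y ∈ t, ENNReal.ofReal (d x y)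

/-- The `k`-dimensional Hausdorff measure (value on a set `A`) of an arbitrary distance
function `d`, with the normalization `sup_δ inf {Σ 2^{-k} (diam E_i)^k}`. -/
def hausdorffWith {α : Type*} (d : α → α → ℝ) (k : ℕ) (A : Set α) : ℝ≥0∞ :=
  ⨆ (δ : ℝ≥0∞) (_ : 0 < δ),
    ⨅ (t : ℕ → Set α) (_ : A ⊆ ⋃ n, t n) (_ : ∀ n, ediamWith d (t n) ≤ δ),
      ∑' n, (2 : ℝ≥0∞)⁻¹ ^ k * ediamWith d (t n) ^ k

/-- A homogeneous seminorm on `ℝ^k`: nonnegative, positively `1`-homogeneous, subadditive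
and continuous. -/
def IsHomSeminorm (k : ℕ) (s : Ek k → ℝ) : Prop :=
  Continuous s ∧ (∀ z : Ek k, 0 ≤ s z) ∧ (∀ r : ℝ, 0 ≤ r → ∀ z : Ek k, s (r • z) = r * s z) ∧
    ∀ z w : Ek k, s (z + w) ≤ s z + s w

/- The metric Jacobian associated with a (candidate) metric differential `s`: the ratio
`H^k_s(B_E(0,1)) / H^k_{|·|}(B_E(0,1))` when `s` is a norm, and `0` otherwise. -/
open scoped Classical in
def metricJacobian (k : ℕ) (s : Ek k → ℝ) : ℝ≥0∞ :=
  if ∀ z : Ek k, z ≠ 0 → 0 < s z then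
    hausdorffWith (fun a b : Ek k => s (a - b)) k (ball (0 : Ek k) 1) /
      hausdorffWith (fun a b : Ek k => dist a b) k (ball (0 : Ek k) 1)
  else 0

/-- `f : A → G` is metrically differentiable at `x` with metric differential `s`:
`s` is a homogeneous seminorm and `d(f(x), f(x+z)) − s(z) = o(|z|)` as `z → 0`, `x + z ∈ A`. -/
def IsMetricDiffAt (k : ℕ) (f : Ek k → G) (A : Set (Ek k)) (x : Ek k) (s : Ek k → ℝ) : Prop :=
  IsHomSeminorm k s ∧
    ∀ ε : ℝ, 0 < ε → ∃ δ : ℝ, 0 < δ ∧ ∀ z : Ek k, x + z ∈ A → ‖z‖ < δ →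
      |dist (f x) (f (x + z)) - s z| ≤ ε * ‖z‖

/-- An h-homomorphism `L : ℝ^k → G`: a group homomorphism commuting with dilations. -/
def IsHHom (k : ℕ) (L : Ek k → G) : Prop :=
  (∀ z w : Ek k, L (z + w) = L z * L w) ∧ ∀ r : ℝ, 0 < r → ∀ z : Ek k, L (r • z) = dil r (L z)

/-- `f : A → G` is differentiable at `x` with differential `L`: `L` is an h-homomorphism and
`d(f(x)⁻¹ f(x+z), L(z)) = o(|z|)` as `z → 0`, `x + z ∈ A`. -/
def IsDiffAt (k : ℕ) (f : Ek k → G) (A : Set (Ek k)) (x : Ek k) (L : Ek k → G) : Prop :=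
  IsHHom k L ∧
    ∀ ε : ℝ, 0 < ε → ∃ δ : ℝ, 0 < δ ∧ ∀ z : Ek k, x + z ∈ A → ‖z‖ < δ →
      dist ((f x)⁻¹ * f (x + z)) (L z) ≤ ε * ‖z‖

/-- `x` is a (Lebesgue) density point of `A ⊆ ℝ^k`. -/
def IsDensityPoint (k : ℕ) (A : Set (Ek k)) (x : Ek k) : Prop :=
  Tendsto (fun r : ℝ => volume (A ∩ ball x r) / volume (ball x r)) (𝓝[>] (0 : ℝ)) (𝓝 1)

end HomogeneousGroup

open HomogeneousGroup
theorem ip_dil_layer_one {G : Type*} [HomogeneousGroup G] (r : ℝ) (x w : G)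
    (hw : w ∈ (layer 1 : Submodule ℝ G)) : ip (dil r x) w = r * ip x w := by
  have hx : x ∈ ⨆ i, (layer i : Submodule ℝ G) := by
    rw [(grading_internal (G := G)).submodule_iSup_eq_top]
    exact Submodule.mem_top
  induction hx using Submodule.iSup_induction' with
  | mem i y hy =>
    rw [dil_layer i r y hy, map_smul, LinearMap.smul_apply, smul_eq_mul]
    by_cases h : i = 1
    · subst h
      rw [pow_one]
    · rw [ip_graded i 1 h y hy w hw, mul_zero, mul_zero]
  | zero => simp only [map_zero, LinearMap.zero_apply, mul_zero]
  | add y z _ _ h1 h2 =>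
    rw [map_add, map_add, map_add, LinearMap.add_apply, LinearMap.add_apply, h1, h2, mul_add]

theorem proj_dil {G : Type*} [HomogeneousGroup G] (V : Set G) (hV : IsHorizontalSubgroup V)
    (π : G → G) (hπ : IsHorizProj V π) (r : ℝ) (hr : 0 < r) (x : G) :
    π (dil r x) = dil r (π x) := by
  obtain ⟨⟨_, ⟨W, hW⟩, hd⟩, hl⟩ := hV
  have h1 := (hπ (dil r x)).1
  have h2 := hd r hr _ (hπ x).1
  have h3 : π (dil r x) - dil r (π x) ∈ V := by
    rw [hW] at h1 h2 ⊢
    exact W.sub_mem h1 h2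
  by_contra hne
  have hpos := ip_pos _ (sub_ne_zero.mpr hne)
  have : ip (π (dil r x) - dil r (π x)) (π (dil r x) - dil r (π x)) = 0 := by
    generalize hw : π (dil r x) - dil r (π x) = w at h3
    nth_rewrite 1 [← hw]
    rw [map_sub, LinearMap.sub_apply, (hπ _).2 w h3, ip_dil_layer_one r x w (hl h3),
      ip_dil_layer_one r (π x) w (hl h3), (hπ _).2 w h3, sub_self]
  exact hpos.ne' this

/-- **Cone separation (inclusion (5.1) in the proof of (iv) ⟹ (i)).** Let `T, V ∈ H(G,k)`
with `ρ(T,V) < 1/3` (distance in the horizontal Grassmannian). Then for every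
`ε₀ ∈ (0, c_G/3)` and every `p ∈ G` one has `X(p, V^⊥, ε₀) ⊆ G ∖ X(p, T, ε₀)`. -/
theorem cone_separation
    {G : Type*} [HomogeneousGroup G]
    (c : ℝ) (hc : IsProjConstant G c)
    (k : ℕ) (hk1 : 1 ≤ k) (hk2 : k ≤ maxHorizDim G)
    (T V : Set G) (hT : IsHorizontal k T) (hV : IsHorizontal k V)
    (πT πV : G → G) (hπT : IsHorizProj T πT) (hπV : IsHorizProj V πV)
    (hρ : grassDist πT πV < 1 / 3)
    (ε₀ : ℝ) (hε1 : 0 < ε₀) (hε2 : ε₀ < c / 3) (p : G) :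
    cone p (vertComp V) ε₀ ⊆ (cone p T ε₀)ᶜ := by
  intro q hq hq'
  have hq1 : infDist (p⁻¹ * q) (vertComp V) < ε₀ * dist p q := hq
  have hq2 : infDist (p⁻¹ * q) T < ε₀ * dist p q := hq'
  have hN : dist p q = homNorm (p⁻¹ * q) := by
    rw [homNorm, ← dist_left_invariant p⁻¹ p q, inv_mul_cancel, dist_comm]
  rw [hN] at hq1 hq2
  generalize p⁻¹ * q = x at hq1 hq2
  have hNpos : 0 < homNorm x := by
    have h := lt_of_le_of_lt infDist_nonneg hq1
    exact (mul_pos_iff_of_pos_left hε1).mp h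
  obtain ⟨c0, c1, hc⟩ := hc
  have a1 := (hc V hV.1 πV hπV x).2.1
  have a2 := (hc T hT.1 πT hπT x).2.2.2.1
  have e1 : (πT x)⁻¹ * (x * (πT x)⁻¹) * πT x = (πT x)⁻¹ * x := by group
  have e2 : homNorm ((πT x)⁻¹ * x) = dist x (πT x) := by
    rw [homNorm, ← dist_left_invariant (πT x)⁻¹ x (πT x), inv_mul_cancel]
  rw [e1, e2] at a2
  have hεN : ε₀ * homNorm x < c * (homNorm x / 3) := by nlinarith
  have b1 : homNorm (πV x) < homNorm x / 3 := by
    refine lt_of_mul_lt_mul_left ?_ c0.le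
    linarith
  have b2 : dist x (πT x) < homNorm x / 3 := by
    refine lt_of_mul_lt_mul_left ?_ c0.le
    linarith
  have hdil1 : ∀ r : ℝ, dil r (1 : G) = 1 := by
    intro r
    rw [one_def, map_zero]
  have hbdd : BddAbove ((fun x : G => dist (πT x) (πV x)) '' {x : G | homNorm x = 1}) := by
    refine ⟨c⁻¹ + c⁻¹, ?_⟩
    rintro _ ⟨y, hy, rfl⟩
    have hy : homNorm y = 1 := hy
    have h1 := (hc V hV.1 πV hπV y).1
    have h2 := (hc T hT.1 πT hπT y).1
    rw [hy, mul_one] at h1 h2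
    unfold homNorm at h1 h2
    have := dist_triangle_right (πT y) (πV y) 1
    show dist (πT y) (πV y) ≤ _
    linarith
  have hr : 0 < (homNorm x)⁻¹ := inv_pos.mpr hNpos
  have hy : homNorm (dil (homNorm x)⁻¹ x) = 1 := by
    have h := dist_dil (homNorm x)⁻¹ hr x 1
    rw [hdil1] at h
    exact h.trans (inv_mul_cancel₀ hNpos.ne')
  have h3 : dist (πT (dil (homNorm x)⁻¹ x)) (πV (dil (homNorm x)⁻¹ x)) ≤ grassDist πT πV :=
    le_csSup hbdd ⟨_, hy, rfl⟩
  rw [proj_dil T hT.1 πT hπT _ hr, proj_dil V hV.1 πV hπV _ hr, dist_dil _ hr] at h3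
  have h4 : (homNorm x)⁻¹ * dist (πT x) (πV x) < 1 / 3 := lt_of_le_of_lt h3 hρ
  rw [inv_mul_lt_iff₀ hNpos] at h4
  have t1 := dist_triangle x (πT x) 1
  have t2 := dist_triangle (πT x) (πV x) 1
  have n1 : homNorm x = dist x 1 := rfl
  have n2 : homNorm (πV x) = dist (πV x) 1 := rfl
  linarith
end
end

section
/- Let G be a homogeneous group, A ⊆ ℝ^k, f : A → G, and let x ∈ A be a density point of A. If f is differentiable at x with differential Df(x), then f is metrically differentiable at x and its metric differential satisfies mdf(x)(h) = d(Df(x)(h), 0) = ‖Df(x)(h)‖ for all h ∈ ℝ^k. -/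
open MeasureTheory Measure Metric Set Filter Topology ENNReal
open scoped NNReal

noncomputable section

open HomogeneousGroup
theorem homNorm_isHomSeminorm {G : Type*} [HomogeneousGroup G] (k : ℕ) (L : Ek k → G)
    (hL : IsHHom k L) : IsHomSeminorm k (fun h : Ek k => homNorm (L h)) := by
  obtain ⟨hadd, hdil⟩ := hL
  have h0 : L 0 = 1 := by
    have h := hadd 0 0
    rw [add_zero] at h
    exact (mul_eq_left.mp h.symm)
  have hsub : ∀ z w : Ek k, homNorm (L (z + w)) ≤ homNorm (L z) + homNorm (L w) := by
    intro z w
    have h1 := HomogeneousGroup.dist_left_invariant (L z) (L w) 1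
    have h2 := dist_triangle (L z * L w) (L z) 1
    rw [mul_one] at h1
    unfold homNorm
    rw [hadd]
    linarith
  have hhom : ∀ r : ℝ, 0 ≤ r → ∀ z : Ek k, homNorm (L (r • z)) = r * homNorm (L z) := by
    intro r hr z
    rcases hr.eq_or_lt with rfl | hr
    · simp [homNorm, h0]
    · have h := HomogeneousGroup.dist_dil r hr (L z) (1 : G)
      have h1 : dil r (1 : G) = 1 := by
        rw [HomogeneousGroup.one_def, map_zero]
      rw [h1] at h
      unfold homNorm
      rw [hdil r hr, h]
  refine ⟨?_, fun z => dist_nonneg, hhom, hsub⟩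
  have hconv : ConvexOn ℝ univ (fun h : Ek k => homNorm (L h)) := by
    refine ⟨convex_univ, ?_⟩
    intro z _ w _ a b ha hb _
    have := hsub (a • z) (b • w)
    rw [hhom a ha, hhom b hb] at this
    simpa using this
  exact hconv.locallyLipschitz.continuous

/-- **Remark 3.10 (differentiability implies metric differentiability).** Let `A ⊆ ℝ^k`,
`f : A → G` and let `x ∈ A` be a density point of `A`. If `f` is differentiable at `x` with
differential `Df(x) = L`, then `f` is metrically differentiable at `x` and
`mdf(x)(h) = d(Df(x)(h), 0) = ‖Df(x)(h)‖` for all `h ∈ ℝ^k`. -/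
theorem differentiable_implies_metrically_differentiable
    {G : Type*} [HomogeneousGroup G]
    (k : ℕ) (A : Set (Ek k)) (f : Ek k → G) (x : Ek k)
    (hxA : x ∈ A) (hx : IsDensityPoint k A x)
    (L : Ek k → G) (hL : IsDiffAt k f A x L) :
    IsMetricDiffAt k f A x (fun h : Ek k => homNorm (L h)) ∧
    ∀ h : Ek k, homNorm (L h) = dist (L h) (1 : G) := by
  refine ⟨⟨homNorm_isHomSeminorm k L hL.1, ?_⟩, fun h => rfl⟩
  intro ε hε
  obtain ⟨δ, hδ, H⟩ := hL.2 ε hε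
  refine ⟨δ, hδ, fun z hz hzδ => ?_⟩
  have h1 := HomogeneousGroup.dist_left_invariant (f x)⁻¹ (f x) (f (x + z))
  rw [inv_mul_cancel] at h1
  refine le_trans ?_ (H z hz hzδ)
  rw [← h1, dist_comm]
  exact abs_dist_sub_le _ _ _
end
end
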